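/- Suppose a ∈ (0,1), L satisfies Assumptions A1 and A2, π_{2n} satisfies (C3), Assumption 2 holds, and p_n ∝ n^{−ε} for some ε ∈ (0,1]. Then for any fixed η ∈ (0,1), δ ∈ (0,1) and any fixed ρ > 2/(η(1−δ)), there is a sequence ε_n → 0 (independent of i, depending on n, η, δ, ρ) such that the probability of type II error of the full Bayes decision rule satisfies t^{FB}_{2i} ≤ [2Φ(√(aρC/ε)) − 1](1 + ε_n) for every i = 1,…,n, where Φ is the standard normal cdf. -/

import Mathlib

open MeasureTheory ProbabilityTheory Real Filter Set

noncomputable section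

namespace PaperGL

/-- Posterior density kernel of the shrinkage coefficient `κ` given `(x, τ)`:
`π(κ | x, τ) ∝ κ^(a-1/2) (1-κ)^(-a-1) L(τ⁻²(κ⁻¹-1)) exp((1-κ)x²/2)` on `(0,1)`. -/
def kdens (a : ℝ) (L : ℝ → ℝ) (x τ κ : ℝ) : ℝ :=
  κ ^ (a - 1/2) * (1 - κ) ^ (-a - 1) * L ((1/τ^2) * (1/κ - 1)) * Real.exp ((1 - κ) * x^2 / 2)

/-- Posterior expectation of `g(κ)` given `(x, τ)`. -/
def kExp (a : ℝ) (L : ℝ → ℝ) (x τ : ℝ) (g : ℝ → ℝ) : ℝ :=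
  (∫ κ in Set.Ioo (0:ℝ) 1, g κ * kdens a L x τ κ) /
    (∫ κ in Set.Ioo (0:ℝ) 1, kdens a L x τ κ)

/-- `E(1−κ | x, τ)`. -/
def E1mK (a : ℝ) (L : ℝ → ℝ) (x τ : ℝ) : ℝ := kExp a L x τ (fun κ => 1 - κ)

/-- Posterior mean `T_τ(x) = x · E(1−κ | x, τ)`. -/
def postMean (a : ℝ) (L : ℝ → ℝ) (τ x : ℝ) : ℝ := x * E1mK a L x τ

/-- Posterior variance `Var(θ | x, τ)` of the mixture over `κ` of `N((1−κ)x, 1−κ)`. -/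
def postVar (a : ℝ) (L : ℝ → ℝ) (x τ : ℝ) : ℝ :=
  E1mK a L x τ + x^2 * (kExp a L x τ (fun κ => (1 - κ)^2) - (E1mK a L x τ)^2)

/-- `E(1−κ | x, τ)` in the `t = τ⁻²(κ⁻¹−1)` parametrisation. -/
def E1mKt (a : ℝ) (L : ℝ → ℝ) (x τ : ℝ) : ℝ :=
  (τ^2 * ∫ t in Set.Ioi (0:ℝ),
      (1 + t*τ^2) ^ (-(3:ℝ)/2) * t ^ (-a) * L t * Real.exp ((x^2/2) * (t*τ^2/(1+t*τ^2)))) /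
  (∫ t in Set.Ioi (0:ℝ),
      (1 + t*τ^2) ^ (-(1:ℝ)/2) * t ^ (-a-1) * L t * Real.exp ((x^2/2) * (t*τ^2/(1+t*τ^2))))

/-- The empirical Bayes estimate `τ̂` of the global shrinkage parameter. -/
def tauHat (c1 c2 : ℝ) (n : ℕ) (x : Fin n → ℝ) : ℝ :=
  max (1/(n:ℝ)) ((1/(c2*n)) * ∑ i, if Real.sqrt (c1 * Real.log n) < |x i| then (1:ℝ) else 0)

/-- Nearly black vectors: `θ ∈ ℓ₀[q]`. -/
def sparse (n q : ℕ) (θ : Fin n → ℝ) : Prop := Nat.card {i : Fin n // θ i ≠ 0} ≤ q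

/-- The sampling distribution `N_n(θ₀, I_n)`. -/
def Pmeas (n : ℕ) (θ0 : Fin n → ℝ) : Measure (Fin n → ℝ) :=
  Measure.pi fun i => gaussianReal (θ0 i) 1

/-- `q_n ∝ n^β` (two-sided proportionality). -/
def propTo (q : ℕ → ℕ) (β : ℝ) : Prop :=
  ∃ k1 k2 : ℝ, 0 < k1 ∧ 0 < k2 ∧
    ∀ᶠ n : ℕ in atTop, k1 * (n:ℝ)^β ≤ (q n : ℝ) ∧ (q n : ℝ) ≤ k2 * (n:ℝ)^β

/-- `p_n ∝ n^(-e)` for a real sequence. -/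
def propToR (p : ℕ → ℝ) (β : ℝ) : Prop :=
  ∃ k1 k2 : ℝ, 0 < k1 ∧ 0 < k2 ∧
    ∀ᶠ n : ℕ in atTop, k1 * (n:ℝ)^β ≤ p n ∧ p n ≤ k2 * (n:ℝ)^β

/-- Assumptions (A1) and (A2) on the slowly varying function `L`, together with
positivity, measurability. -/
def AssumpL (L : ℝ → ℝ) (Mb c0 t0 : ℝ) : Prop :=
  Measurable L ∧ (∀ t, 0 < t → 0 < L t) ∧ (∀ t, 0 < t → L t ≤ Mb) ∧
    0 < c0 ∧ 0 < t0 ∧ ∀ t, t0 ≤ t → c0 ≤ L t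

/-- Integrability of `t^(−a−1) L t` on `(0,∞)` with positive integral, and `K` its inverse. -/
def Kcond (a : ℝ) (L : ℝ → ℝ) (K : ℝ) : Prop :=
  MeasureTheory.IntegrableOn (fun t => t ^ (-a-1) * L t) (Set.Ioi (0:ℝ)) ∧
    0 < ∫ t in Set.Ioi (0:ℝ), t ^ (-a-1) * L t ∧
    K = (∫ t in Set.Ioi (0:ℝ), t ^ (-a-1) * L t)⁻¹

/-- The κ-posterior as a probability measure on `(0,1)`. -/
def kPostMeasure (a : ℝ) (L : ℝ → ℝ) (x τ : ℝ) : Measure ℝ :=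
  (∫⁻ κ in Set.Ioo (0:ℝ) 1, ENNReal.ofReal (kdens a L x τ κ))⁻¹ •
    ((volume.restrict (Set.Ioo (0:ℝ) 1)).withDensity fun κ => ENNReal.ofReal (kdens a L x τ κ))

/-- The posterior distribution of `θ` given `(x, τ)`: mixture over `κ` of `N((1−κ)x, 1−κ)`. -/
def thetaPost (a : ℝ) (L : ℝ → ℝ) (x τ : ℝ) : Measure ℝ :=
  (kPostMeasure a L x τ).bind fun κ => gaussianReal ((1-κ)*x) (Real.toNNReal (1-κ))

/-- `Π_τ(· | X)`: the posterior of the vector `θ` given `(X, τ)`. -/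
def PiTau (a : ℝ) (L : ℝ → ℝ) (n : ℕ) (X : Fin n → ℝ) (τ : ℝ) : Measure (Fin n → ℝ) :=
  Measure.pi fun i => thetaPost a L (X i) τ

/-- Marginal density `m(x, τ)` of one observation given `τ` (mixing over `l = λ²`). -/
def marg (a K : ℝ) (L : ℝ → ℝ) (x τ : ℝ) : ℝ :=
  ∫ l in Set.Ioi (0:ℝ), K * l ^ (-a-1) * L l *
    ((Real.sqrt (2 * Real.pi * (1 + l * τ^2)))⁻¹ * Real.exp (-(x^2) / (2 * (1 + l * τ^2))))

/-- Posterior density of `τ` given `X`, for a prior `π2` supported on `[lo, hi]`. -/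
def tauWeight (a K : ℝ) (L : ℝ → ℝ) (π2 : ℝ → ℝ) (lo hi : ℝ) (n : ℕ)
    (X : Fin n → ℝ) (τ : ℝ) : ℝ :=
  (π2 τ * ∏ i, marg a K L (X i) τ) /
    ∫ s in Set.Icc lo hi, π2 s * ∏ i, marg a K L (X i) s

/-- Full Bayes posterior mean `θ̂_i = ∫ T_τ(X_i) π_{2n}(τ|X) dτ`. -/
def fbMean (a K : ℝ) (L : ℝ → ℝ) (π2 : ℝ → ℝ) (n : ℕ) (X : Fin n → ℝ) (i : Fin n) : ℝ :=
  ∫ τ in Set.Icc ((n:ℝ)⁻¹) 1, postMean a L τ (X i) * tauWeight a K L π2 ((n:ℝ)⁻¹) 1 n X τ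

/-- Full Bayes posterior variance `Var(θ_i | X)`. -/
def fbVar (a K : ℝ) (L : ℝ → ℝ) (π2 : ℝ → ℝ) (n : ℕ) (X : Fin n → ℝ) (i : Fin n) : ℝ :=
  (∫ τ in Set.Icc ((n:ℝ)⁻¹) 1,
      (postVar a L (X i) τ + (postMean a L τ (X i))^2) * tauWeight a K L π2 ((n:ℝ)⁻¹) 1 n X τ)
    - (fbMean a K L π2 n X i)^2

/-- The posterior distribution of `τ` given `X`, as a measure on `[lo, hi]`. -/
def tauPostMeasure (a K : ℝ) (L : ℝ → ℝ) (π2 : ℝ → ℝ) (lo hi : ℝ) (n : ℕ)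
    (X : Fin n → ℝ) : Measure ℝ :=
  (∫⁻ τ in Set.Icc lo hi, ENNReal.ofReal (π2 τ * ∏ i, marg a K L (X i) τ))⁻¹ •
    ((volume.restrict (Set.Icc lo hi)).withDensity
      fun τ => ENNReal.ofReal (π2 τ * ∏ i, marg a K L (X i) τ))

/-- The full Bayes posterior `Π(· | X)` of `θ` given `X`. -/
def PiFull (a K : ℝ) (L : ℝ → ℝ) (π2 : ℝ → ℝ) (n : ℕ) (X : Fin n → ℝ) :
    Measure (Fin n → ℝ) :=
  (tauPostMeasure a K L π2 ((n:ℝ)⁻¹) 1 n X).bind fun τ => PiTau a L n X τ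

/-- Condition (C1): `π_{2n}` is a density supported on `[1/n, 1]`. -/
def CondC1 (π2 : ℕ → ℝ → ℝ) : Prop :=
  (∀ (n : ℕ) (τ : ℝ), 0 ≤ π2 n τ) ∧ (∀ (n : ℕ) (τ : ℝ), τ ∉ Set.Icc ((n:ℝ)⁻¹) 1 → π2 n τ = 0) ∧
    ∀ n : ℕ, 1 ≤ n → ∫ τ in Set.Icc ((n:ℝ)⁻¹) 1, π2 n τ = 1

/-- `t_n = C_u π^{3/2} (q_n/n) √(log(n/q_n))`. -/
def tseq (Cu : ℝ) (q : ℕ → ℕ) (n : ℕ) : ℝ :=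
  Cu * Real.pi ^ ((3:ℝ)/2) * ((q n : ℝ)/n) * Real.sqrt (Real.log ((n:ℝ)/(q n)))

/-- Condition (C2). -/
def CondC2 (π2 : ℕ → ℝ → ℝ) (q : ℕ → ℕ) : Prop :=
  ∃ Cu c M1 K' : ℝ, 0 < Cu ∧ c ≤ Cu/2 ∧ 1 ≤ M1 ∧ 0 < K' ∧
    ∀ᶠ n : ℕ in atTop,
      K' * Real.exp (-c * q n) ≤
        ((q n : ℝ)/n)^M1 * ∫ τ in Set.Icc (tseq Cu q n / 2) (tseq Cu q n), π2 n τ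

/-- Full Bayes posterior shrinkage weight `E(1−κ_i | X)`. -/
def fbShrink (a K : ℝ) (L : ℝ → ℝ) (π2 : ℝ → ℝ) (lo hi : ℝ) (n : ℕ)
    (X : Fin n → ℝ) (i : Fin n) : ℝ :=
  ∫ τ in Set.Icc lo hi, E1mK a L (X i) τ * tauWeight a K L π2 lo hi n X τ

/-- Marginal two-groups distribution of one observation:
`(1−p) N(0,1) + p N(0, 1+ψ²)` with `u = ψ²`. -/
def mixM (p u : ℝ) : Measure ℝ :=
  ENNReal.ofReal (1 - p) • gaussianReal 0 1 +
    ENNReal.ofReal p • gaussianReal 0 (Real.toNNReal (1 + u))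

/-- Joint law of `X` given `ν_i = 0`. -/
def nullMeas (n : ℕ) (i : Fin n) (p u : ℝ) : Measure (Fin n → ℝ) :=
  Measure.pi fun j => if j = i then gaussianReal 0 1 else mixM p u

/-- Joint law of `X` given `ν_i = 1`. -/
def altMeas (n : ℕ) (i : Fin n) (p u : ℝ) : Measure (Fin n → ℝ) :=
  Measure.pi fun j => if j = i then gaussianReal 0 (Real.toNNReal (1 + u)) else mixM p u

/-- Type I error `t^{FB}_{1i}` of the full Bayes rule. -/
def t1FB (a K : ℝ) (L : ℝ → ℝ) (π2 : ℕ → ℝ → ℝ) (α : ℕ → ℝ) (p u : ℕ → ℝ)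
    (n : ℕ) (i : Fin n) : ℝ :=
  ((nullMeas n i (p n) (u n))
    {x | 1/2 < fbShrink a K L (π2 n) ((n:ℝ)⁻¹) (α n) n x i}).toReal

/-- Type II error `t^{FB}_{2i}` of the full Bayes rule. -/
def t2FB (a K : ℝ) (L : ℝ → ℝ) (π2 : ℕ → ℝ → ℝ) (α : ℕ → ℝ) (p u : ℕ → ℝ)
    (n : ℕ) (i : Fin n) : ℝ :=
  ((altMeas n i (p n) (u n))
    {x | fbShrink a K L (π2 n) ((n:ℝ)⁻¹) (α n) n x i ≤ 1/2}).toReal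

/-- Bayes risk `R^{FB}_{OG}` of the full Bayes rule. -/
def RFB (a K : ℝ) (L : ℝ → ℝ) (π2 : ℕ → ℝ → ℝ) (α : ℕ → ℝ) (p u : ℕ → ℝ) (n : ℕ) : ℝ :=
  ∑ i : Fin n, ((1 - p n) * t1FB a K L π2 α p u n i + p n * t2FB a K L π2 α p u n i)

/-- Condition (C3): `π_{2n}` is a density supported on `[1/n, α_n]`,
with `α_n → 0` and `n α_n → ∞`. -/
def CondC3 (π2 : ℕ → ℝ → ℝ) (α : ℕ → ℝ) : Prop :=
  (∀ (n : ℕ) (τ : ℝ), 0 ≤ π2 n τ) ∧ (∀ (n : ℕ) (τ : ℝ), τ ∉ Set.Icc ((n:ℝ)⁻¹) (α n) → π2 n τ = 0) ∧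
    (∀ n : ℕ, 1 ≤ n → ∫ τ in Set.Icc ((n:ℝ)⁻¹) (α n), π2 n τ = 1) ∧
    Tendsto α atTop (nhds 0) ∧ Tendsto (fun n : ℕ => (n:ℝ) * α n) atTop atTop

/-- Assumption 2 of Bogdan et al.: `p_n → 0`, `u_n = ψ_n² → ∞`,
`log v_n / u_n → C ∈ (0,∞)` with `v_n = u_n f_n²`, `f_n = (1-p_n)/p_n`. -/
def Assump2 (p u : ℕ → ℝ) (C : ℝ) : Prop :=
  Tendsto p atTop (nhds 0) ∧ Tendsto u atTop atTop ∧ 0 < C ∧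
    Tendsto (fun n => Real.log (u n * ((1 - p n)/p n)^2) / u n) atTop (nhds C)

/-- Standard normal cdf. -/
def Phi (z : ℝ) : ℝ := ((gaussianReal 0 1) (Set.Iic z)).toReal

/-- Squared threshold of the Bayes Oracle. -/
def csq (p u : ℕ → ℝ) (n : ℕ) : ℝ :=
  ((1 + u n)/u n) * (Real.log (1 + u n) + 2 * Real.log ((1 - p n)/p n))

/-- Type I error of the Bayes Oracle. -/
def t1BO (p u : ℕ → ℝ) (n : ℕ) : ℝ :=
  ((gaussianReal 0 1) {x : ℝ | csq p u n < x^2}).toReal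

/-- Type II error of the Bayes Oracle. -/
def t2BO (p u : ℕ → ℝ) (n : ℕ) : ℝ :=
  ((gaussianReal 0 (Real.toNNReal (1 + u n))) {x : ℝ | x^2 ≤ csq p u n}).toReal

/-- Bayes risk of the Bayes Oracle. -/
def RBO (p u : ℕ → ℝ) (n : ℕ) : ℝ :=
  (n:ℝ) * ((1 - p n) * t1BO p u n + p n * t2BO p u n)

end PaperGL

namespace PaperGL

/-- Dominating kernel on `(0,1)`: the pull-back of `t^(-a-1) L t` along
`κ ↦ τ⁻²(κ⁻¹-1)`, up to the factor `τ^(-2a)`. -/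
def tiltKernel (a : ℝ) (L : ℝ → ℝ) (τ κ : ℝ) : ℝ :=
  κ ^ (a - 1) * (1 - κ) ^ (-a - 1) * L ((1/τ^2) * (1/κ - 1))

lemma oddsMap_pos {τ κ : ℝ} (hτ : 0 < τ) (hκ : κ ∈ Set.Ioo (0:ℝ) 1) :
    0 < (1/τ^2) * (1/κ - 1) := by
  have h1 : 1 < 1/κ := by rw [lt_div_iff₀ hκ.1]; linarith [hκ.2]
  have : 0 < 1/κ - 1 := by linarith
  positivity

lemma oddsMap_image {τ : ℝ} (hτ : 0 < τ) :
    (fun κ : ℝ => (1/τ^2) * (1/κ - 1)) '' Set.Ioo (0:ℝ) 1 = Set.Ioi 0 := by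
  ext t
  constructor
  · rintro ⟨κ, hκ, rfl⟩
    exact oddsMap_pos hτ hκ
  · intro ht
    have ht' : 0 < t := ht
    have hp : 0 < t * τ^2 := by positivity
    refine ⟨1/(1 + t*τ^2), ⟨by positivity, ?_⟩, ?_⟩
    · rw [div_lt_one (by positivity)]; linarith
    · field_simp
      ring

lemma oddsMap_hasDerivWithinAt {τ κ : ℝ} (hκ : κ ∈ Set.Ioo (0:ℝ) 1) :
    HasDerivWithinAt (fun κ : ℝ => (1/τ^2) * (1/κ - 1)) ((1/τ^2) * (-(κ^2)⁻¹))
      (Set.Ioo (0:ℝ) 1) κ := by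
  have h := ((hasDerivAt_inv hκ.1.ne').sub_const 1).const_mul (1/τ^2)
  simpa only [one_div] using h.hasDerivWithinAt

lemma oddsMap_injOn {τ : ℝ} (hτ : 0 < τ) :
    Set.InjOn (fun κ : ℝ => (1/τ^2) * (1/κ - 1)) (Set.Ioo (0:ℝ) 1) := by
  intro x hx y hy h
  have hne : (1/τ^2) ≠ 0 := by positivity
  have h2 := mul_left_cancel₀ hne h
  simpa using h2

lemma tiltKernel_eq {a : ℝ} {L : ℝ → ℝ} {τ κ : ℝ} (hτ : 0 < τ) (hκ : κ ∈ Set.Ioo (0:ℝ) 1) :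
    tiltKernel a L τ κ = (τ^2)^(-a) * (|(1/τ^2) * (-(κ^2)⁻¹)| •
      ((fun t => t ^ (-a-1) * L t) ((1/τ^2) * (1/κ - 1)))) := by
  obtain ⟨h0, h1⟩ := hκ
  have h2 : 0 < 1 - κ := by linarith
  have hT : 0 < τ^2 := by positivity
  have e1 : |(1/τ^2) * (-(κ^2)⁻¹)| = (τ^2)⁻¹ * (κ^2)⁻¹ := by
    rw [mul_neg, abs_neg, abs_of_pos (by positivity), one_div]
  have e2 : (1/τ^2) * (1/κ - 1) = (τ^2)⁻¹ * κ⁻¹ * (1 - κ) := by field_simp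
  have e3 : ((τ^2)⁻¹ * κ⁻¹ * (1 - κ)) ^ (-a-1)
      = (τ^2) ^ (a+1) * κ ^ (a+1) * (1 - κ) ^ (-a-1) := by
    rw [Real.mul_rpow (by positivity) h2.le, Real.mul_rpow (by positivity) (by positivity),
      Real.inv_rpow hT.le, Real.inv_rpow h0.le, ← Real.rpow_neg hT.le, ← Real.rpow_neg h0.le]
    congr 3 <;> ring
  have e4 : (τ^2)^(-a) * ((τ^2)⁻¹ * (τ^2) ^ (a+1)) = 1 := by
    rw [← Real.rpow_neg_one, ← Real.rpow_add hT, ← Real.rpow_add hT]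
    ring_nf
    simp
  have e5 : (κ^2)⁻¹ * κ ^ (a+1) = κ ^ (a-1) := by
    rw [← Real.rpow_natCast, ← Real.rpow_neg h0.le, ← Real.rpow_add h0]
    congr 1
    push_cast
    ring
  rw [tiltKernel, e1]
  simp only [smul_eq_mul]
  rw [e2, e3, ← e5]
  linear_combination (-(κ^2)⁻¹ * κ ^ (a+1) * (1 - κ) ^ (-a-1) * L ((τ^2)⁻¹ * κ⁻¹ * (1 - κ))) * e4

lemma integrableOn_tiltKernel {a : ℝ} {L : ℝ → ℝ} {τ : ℝ} (hτ : 0 < τ)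
    (hI : IntegrableOn (fun t => t ^ (-a-1) * L t) (Set.Ioi (0:ℝ))) :
    IntegrableOn (tiltKernel a L τ) (Set.Ioo (0:ℝ) 1) := by
  rw [← oddsMap_image hτ, integrableOn_image_iff_integrableOn_abs_deriv_smul measurableSet_Ioo
    (fun κ hκ => oddsMap_hasDerivWithinAt hκ) (oddsMap_injOn hτ)] at hI
  exact IntegrableOn.congr_fun (Integrable.const_mul hI ((τ^2)^(-a)))
    (fun κ hκ => (tiltKernel_eq hτ hκ).symm) measurableSet_Ioo

lemma integral_tiltKernel {a : ℝ} {L : ℝ → ℝ} {τ : ℝ} (hτ : 0 < τ) :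
    ∫ κ in Set.Ioo (0:ℝ) 1, tiltKernel a L τ κ
      = (τ^2)^(-a) * ∫ t in Set.Ioi (0:ℝ), t ^ (-a-1) * L t := by
  rw [setIntegral_congr_fun measurableSet_Ioo (fun κ hκ => tiltKernel_eq hτ hκ),
    integral_const_mul, ← oddsMap_image hτ, integral_image_eq_integral_abs_deriv_smul
    measurableSet_Ioo (fun κ hκ => oddsMap_hasDerivWithinAt hκ) (oddsMap_injOn hτ)]

lemma kdens_pos {a : ℝ} {L : ℝ → ℝ} (hL : ∀ t, 0 < t → 0 < L t) {x τ κ : ℝ} (hτ : 0 < τ)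
    (hκ : κ ∈ Set.Ioo (0:ℝ) 1) : 0 < kdens a L x τ κ := by
  have h1 := hL _ (oddsMap_pos hτ hκ)
  have h2 : 0 < 1 - κ := by linarith [hκ.2]
  have h0 := hκ.1
  unfold kdens
  positivity

lemma kdens_le_tiltKernel {a : ℝ} {L : ℝ → ℝ} (hL : ∀ t, 0 < t → 0 < L t) {x τ κ b : ℝ}
    (hτ : 0 < τ) (hκ : κ ∈ Set.Ioo (0:ℝ) 1) (hb : 1 - κ ≤ b) :
    kdens a L x τ κ ≤ Real.exp (b * x^2 / 2) * tiltKernel a L τ κ := by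
  have h1 := hL _ (oddsMap_pos hτ hκ)
  have h2 : 0 < 1 - κ := by linarith [hκ.2]
  have h0 := hκ.1
  have e1 : κ ^ (a - 1/2) ≤ κ ^ (a - 1) :=
    Real.rpow_le_rpow_of_exponent_ge h0 hκ.2.le (by linarith)
  have e2 : Real.exp ((1 - κ) * x^2 / 2) ≤ Real.exp (b * x^2 / 2) := by
    gcongr
  unfold kdens tiltKernel
  rw [mul_comm (Real.exp (b * x^2 / 2))]
  gcongr

lemma measurable_kdens_uncurry (a : ℝ) {L : ℝ → ℝ} (hL : Measurable L) (x : ℝ) :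
    Measurable (Function.uncurry fun τ κ => kdens a L x τ κ) := by
  unfold kdens Function.uncurry
  have : Measurable fun z : ℝ × ℝ => L ((1/z.1^2) * (1/z.2 - 1)) := hL.comp (by fun_prop)
  fun_prop

lemma measurable_kdens (a : ℝ) {L : ℝ → ℝ} (hL : Measurable L) (x τ : ℝ) :
    Measurable (kdens a L x τ) :=
  (measurable_kdens_uncurry a hL x).comp measurable_prodMk_left

lemma measurable_E1mK (a : ℝ) {L : ℝ → ℝ} (hL : Measurable L) (x : ℝ) :
    Measurable (fun τ => E1mK a L x τ) := by
  have h := measurable_kdens_uncurry a hL x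
  have h2 : Measurable (Function.uncurry fun τ κ => (1 - κ) * kdens a L x τ κ) :=
    (measurable_const.sub measurable_snd).mul h
  exact h2.stronglyMeasurable.integral_prod_right.measurable.div
    h.stronglyMeasurable.integral_prod_right.measurable

lemma integrableOn_kdens {a : ℝ} {L : ℝ → ℝ} (hLm : Measurable L) (hL : ∀ t, 0 < t → 0 < L t)
    (hI : IntegrableOn (fun t => t ^ (-a-1) * L t) (Set.Ioi (0:ℝ))) {τ : ℝ} (hτ : 0 < τ) (x : ℝ) :
    IntegrableOn (kdens a L x τ) (Set.Ioo (0:ℝ) 1) := by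
  refine Integrable.mono' ((integrableOn_tiltKernel hτ hI).const_mul (Real.exp (1 * x^2 / 2)))
    (measurable_kdens a hLm x τ).aestronglyMeasurable ?_
  refine (ae_restrict_iff' measurableSet_Ioo).2 (.of_forall fun κ hκ => ?_)
  rw [Real.norm_of_nonneg (kdens_pos hL hτ hκ).le]
  exact kdens_le_tiltKernel hL hτ hκ (by linarith [hκ.1])

lemma integrableOn_mul_kdens {a : ℝ} {L : ℝ → ℝ} (hLm : Measurable L)
    (hL : ∀ t, 0 < t → 0 < L t)
    (hI : IntegrableOn (fun t => t ^ (-a-1) * L t) (Set.Ioi (0:ℝ))) {τ : ℝ} (hτ : 0 < τ) (x : ℝ)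
    {g : ℝ → ℝ} (hg : Measurable g) (hg1 : ∀ κ ∈ Set.Ioo (0:ℝ) 1, |g κ| ≤ 1) :
    IntegrableOn (fun κ => g κ * kdens a L x τ κ) (Set.Ioo (0:ℝ) 1) :=
  (integrableOn_kdens hLm hL hI hτ x).bdd_mul (c := 1) hg.aestronglyMeasurable
    ((ae_restrict_iff' measurableSet_Ioo).2 (.of_forall hg1))

lemma integral_kdens_pos {a : ℝ} {L : ℝ → ℝ} (hLm : Measurable L) (hL : ∀ t, 0 < t → 0 < L t)
    (hI : IntegrableOn (fun t => t ^ (-a-1) * L t) (Set.Ioi (0:ℝ))) {τ : ℝ} (hτ : 0 < τ) (x : ℝ) :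
    0 < ∫ κ in Set.Ioo (0:ℝ) 1, kdens a L x τ κ := by
  rw [setIntegral_pos_iff_support_of_nonneg_ae _ (integrableOn_kdens hLm hL hI hτ x)]
  · have hsub : Set.Ioo (0:ℝ) 1 ⊆ Function.support (kdens a L x τ) :=
      fun κ hκ => (kdens_pos hL hτ hκ).ne'
    rw [Set.inter_eq_right.2 hsub]
    simp
  · exact (ae_restrict_iff' measurableSet_Ioo).2
      (.of_forall fun κ hκ => (kdens_pos hL hτ hκ).le)

lemma E1mK_le_one {a : ℝ} {L : ℝ → ℝ} (hLm : Measurable L) (hL : ∀ t, 0 < t → 0 < L t)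
    (hI : IntegrableOn (fun t => t ^ (-a-1) * L t) (Set.Ioi (0:ℝ))) {τ : ℝ} (hτ : 0 < τ) (x : ℝ) :
    E1mK a L x τ ≤ 1 := by
  unfold E1mK kExp
  rw [div_le_one (integral_kdens_pos hLm hL hI hτ x)]
  refine setIntegral_mono_on (integrableOn_mul_kdens hLm hL hI hτ x (by fun_prop) ?_)
    (integrableOn_kdens hLm hL hI hτ x) measurableSet_Ioo fun κ hκ => ?_
  · intro κ hκ
    rw [abs_le]
    constructor <;> linarith [hκ.1, hκ.2]
  · have := kdens_pos (a := a) (x := x) hL hτ hκ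
    nlinarith [hκ.1]

lemma half_lt_E1mK {a : ℝ} {L : ℝ → ℝ} (hLm : Measurable L) (hL : ∀ t, 0 < t → 0 < L t)
    (hI : IntegrableOn (fun t => t ^ (-a-1) * L t) (Set.Ioi (0:ℝ))) {τ : ℝ} (hτ : 0 < τ) {x : ℝ}
    (h : 0 < ∫ κ in Set.Ioo (0:ℝ) 1, (1/2 - κ) * kdens a L x τ κ) :
    1/2 < E1mK a L x τ := by
  unfold E1mK kExp
  rw [lt_div_iff₀ (integral_kdens_pos hLm hL hI hτ x), ← integral_const_mul, ← sub_pos,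
    ← integral_sub]
  · refine h.trans_eq (integral_congr_ae (.of_forall fun κ => ?_))
    simp only
    ring
  · refine integrableOn_mul_kdens hLm hL hI hτ x (by fun_prop) fun κ hκ => ?_
    rw [abs_le]
    constructor <;> linarith [hκ.1, hκ.2]
  · exact (integrableOn_kdens hLm hL hI hτ x).const_mul _

/-- Pointwise lower bound on `(1/2-κ)π(κ|x,τ)` that separates the region near `κ = 0`, the
middle region, and the region near `κ = 1`. -/
lemma kdens_centered_lower {a : ℝ} (ha : 0 < a ∧ a < 1) {L : ℝ → ℝ} {Mb c0 t0 : ℝ}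
    (hL : AssumpL L Mb c0 t0) {τ : ℝ} (hτ : 0 < τ) (hτ0 : t0 * τ^2 ≤ 1) (x : ℝ) {ξ : ℝ}
    (hξ : 0 < ξ) (hξ4 : ξ < 1/4) {κ : ℝ} (hκ : κ ∈ Set.Ioo (0:ℝ) 1) :
    (Set.Ioo (ξ/2) ξ).indicator (fun _ => c0 * ξ / 8 * Real.exp ((1 - ξ) * x^2 / 2)) κ
      - (ξ ^ (-a-1) * Mb * Real.exp (x^2 / 4)
        + Real.exp (ξ * x^2 / 2) * tiltKernel a L τ κ) ≤ (1/2 - κ) * kdens a L x τ κ := by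
  obtain ⟨hLm, hpos, hM, hc0, ht0, hlow⟩ := hL
  have hk := kdens_pos (a := a) (x := x) hpos hτ hκ
  have hLp := hpos _ (oddsMap_pos hτ hκ)
  have hLM := hM _ (oddsMap_pos hτ hκ)
  have h0 := hκ.1
  have h1 : 0 < 1 - κ := by linarith [hκ.2]
  have hMb : 0 < Mb := hLp.trans_le hLM
  have hA : 0 ≤ ξ ^ (-a-1) * Mb * Real.exp (x^2 / 4) := by positivity
  have hB : 0 ≤ Real.exp (ξ * x^2 / 2) * tiltKernel a L τ κ := by
    unfold tiltKernel; positivity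
  rcases le_or_gt κ (1/2) with hhalf | hhalf
  · by_cases hmem : κ ∈ Set.Ioo (ξ/2) ξ
    · rw [Set.indicator_of_mem hmem]
      obtain ⟨hm1, hm2⟩ := hmem
      have hc : c0 ≤ L ((1/τ^2) * (1/κ - 1)) := by
        apply hlow
        have e1 : t0 ≤ 1/τ^2 := by rw [le_div_iff₀ (by positivity)]; exact hτ0
        have e2 : 1 ≤ 1/κ - 1 := by
          rw [le_sub_iff_add_le, le_div_iff₀ h0]; linarith
        calc t0 ≤ 1/τ^2 * 1 := by linarith
          _ ≤ _ := by gcongr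
      have e3 : κ ≤ κ ^ (a - 1/2) := by
        have := Real.rpow_le_rpow_of_exponent_ge h0 hκ.2.le (show a - 1/2 ≤ 1 by linarith [ha.2])
        rwa [Real.rpow_one] at this
      have e4 : 1 ≤ (1 - κ) ^ (-a-1) :=
        Real.one_le_rpow_of_pos_of_le_one_of_nonpos h1 (by linarith) (by linarith [ha.1])
      have hx2 := sq_nonneg x
      have e5 : Real.exp ((1 - ξ) * x^2 / 2) ≤ Real.exp ((1 - κ) * x^2 / 2) := by
        gcongr
      have e6 : (ξ/2) * 1 * c0 * Real.exp ((1 - ξ) * x^2 / 2) ≤ kdens a L x τ κ := by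
        unfold kdens
        gcongr
        linarith
      have e7 : (1/4) * kdens a L x τ κ ≤ (1/2 - κ) * kdens a L x τ κ := by
        gcongr
        linarith
      linarith
    · rw [Set.indicator_of_notMem hmem]
      have : 0 ≤ (1/2 - κ) * kdens a L x τ κ := mul_nonneg (by linarith) hk.le
      linarith
  · rw [Set.indicator_of_notMem (fun h => by linarith [h.2])]
    have hle : -(kdens a L x τ κ) / 2 ≤ (1/2 - κ) * kdens a L x τ κ := by
      nlinarith [hκ.2]
    rcases le_or_gt (1 - κ) ξ with hc | hc
    · have := kdens_le_tiltKernel (a := a) (x := x) hpos hτ hκ hc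
      linarith
    · have f1 : κ ^ (a - 1/2) ≤ 2 := by
        have g1 := Real.rpow_le_rpow_of_exponent_ge h0 hκ.2.le
          (show -1 ≤ a - 1/2 by linarith [ha.1])
        rw [Real.rpow_neg_one] at g1
        have g2 : κ⁻¹ ≤ 2 := by
          rw [inv_le_comm₀ h0 (by norm_num)]; linarith
        linarith
      have f2 : (1 - κ) ^ (-a-1) ≤ ξ ^ (-a-1) :=
        Real.rpow_le_rpow_of_nonpos hξ hc.le (by linarith [ha.1])
      have f3 : Real.exp ((1 - κ) * x^2 / 2) ≤ Real.exp (x^2 / 4) := by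
        apply Real.exp_le_exp.2
        nlinarith [sq_nonneg x]
      have f4 : kdens a L x τ κ ≤ 2 * ξ ^ (-a-1) * Mb * Real.exp (x^2 / 4) := by
        unfold kdens
        gcongr
      linarith

lemma integral_centered_lower {a : ℝ} (ha : 0 < a ∧ a < 1) {L : ℝ → ℝ} {Mb c0 t0 : ℝ}
    (hL : AssumpL L Mb c0 t0)
    (hI : IntegrableOn (fun t => t ^ (-a-1) * L t) (Set.Ioi (0:ℝ)))
    {τ : ℝ} (hτ : 0 < τ) (hτ0 : t0 * τ^2 ≤ 1) (x : ℝ) {ξ : ℝ} (hξ : 0 < ξ) (hξ4 : ξ < 1/4) :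
    c0 * ξ^2 / 16 * Real.exp ((1 - ξ) * x^2 / 2)
      - (ξ ^ (-a-1) * Mb * Real.exp (x^2 / 4) + Real.exp (ξ * x^2 / 2) *
        ((τ^2)^(-a) * ∫ t in Set.Ioi (0:ℝ), t ^ (-a-1) * L t))
      ≤ ∫ κ in Set.Ioo (0:ℝ) 1, (1/2 - κ) * kdens a L x τ κ := by
  have i1 : IntegrableOn ((Set.Ioo (ξ/2) ξ).indicator
      (fun _ => c0 * ξ / 8 * Real.exp ((1 - ξ) * x^2 / 2))) (Set.Ioo (0:ℝ) 1) :=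
    (integrable_const _).indicator measurableSet_Ioo
  have i2 : IntegrableOn (fun _ : ℝ => ξ ^ (-a-1) * Mb * Real.exp (x^2 / 4)) (Set.Ioo (0:ℝ) 1) :=
    integrable_const _
  have i3 := (integrableOn_tiltKernel hτ hI).const_mul (Real.exp (ξ * x^2 / 2))
  have hmain := setIntegral_mono_on (i1.sub (i2.add i3))
    (integrableOn_mul_kdens hL.1 hL.2.1 hI hτ x (g := fun κ => 1/2 - κ) (by fun_prop)
      (fun κ hκ => by rw [abs_le]; constructor <;> linarith [hκ.1, hκ.2])) measurableSet_Ioo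
    (fun κ hκ => kdens_centered_lower ha hL hτ hτ0 x hξ hξ4 hκ)
  refine le_of_eq_of_le ?_ hmain
  rw [integral_sub' i1 (i2.add i3), integral_add' i2 i3, integral_const_mul (Real.exp (ξ * x^2 / 2)), integral_tiltKernel hτ,
    setIntegral_indicator measurableSet_Ioo,
    Set.inter_eq_right.2 (Set.Ioo_subset_Ioo (by linarith) (by linarith))]
  simp only [setIntegral_const, measureReal_def, Real.volume_Ioo, smul_eq_mul]
  rw [ENNReal.toReal_ofReal (by linarith), ENNReal.toReal_ofReal (by norm_num)]
  ring

lemma exists_exp_dominates {A B D ξ ρ : ℝ} (hA : 0 < A) (hξ4 : ξ < 1/4)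
    (hξρ : 2 * ξ < 1 - 2/ρ) :
    ∃ Y : ℝ, ∀ y, Y ≤ y →
      B * Real.exp (y / 4) + Real.exp (ξ * y / 2) * (Real.exp (y/ρ) * D)
        < A * Real.exp ((1 - ξ) * y / 2) := by
  have t1 : ∀ c : ℝ, 0 < c → Tendsto (fun y : ℝ => Real.exp (-(c * y))) atTop (nhds 0) :=
    fun c hc => Real.tendsto_exp_neg_atTop_nhds_zero.comp (tendsto_id.const_mul_atTop hc)
  have hc1 : 0 < (1 - ξ)/2 - 1/4 := by linarith
  have hc2 : 0 < (1 - ξ)/2 - ξ/2 - 1/ρ := by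
    have : 2/ρ = 2 * (1/ρ) := by ring
    linarith
  have t2 := ((t1 _ hc1).const_mul B).add ((t1 _ hc2).const_mul D)
  rw [mul_zero, mul_zero, add_zero] at t2
  obtain ⟨Y, hY⟩ := eventually_atTop.1 (t2.eventually (gt_mem_nhds hA))
  refine ⟨Y, fun y hy => ?_⟩
  have h := mul_lt_mul_of_pos_right (hY y hy) (Real.exp_pos ((1 - ξ) * y / 2))
  refine lt_of_eq_of_lt ?_ h
  rw [add_mul, mul_assoc B, mul_assoc D, ← Real.exp_add, ← Real.exp_add, ← mul_assoc,
    ← Real.exp_add, mul_comm _ D]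
  congr 3 <;> ring

/-- Uniformly over small `τ`, the posterior mean of `1-κ` exceeds `1/2` once `x²` is large and
exceeds `ρ log(τ^(-2a))` with `ρ > 2`. -/
lemma exists_half_lt_E1mK {a : ℝ} (ha : 0 < a ∧ a < 1) {L : ℝ → ℝ} {Mb c0 t0 : ℝ}
    (hL : AssumpL L Mb c0 t0)
    (hI : IntegrableOn (fun t => t ^ (-a-1) * L t) (Set.Ioi (0:ℝ)))
    {ρ : ℝ} (hρ : 2 < ρ) :
    ∃ Y : ℝ, ∀ x τ : ℝ, 0 < τ → t0 * τ^2 ≤ 1 → Y ≤ x^2 → (τ^2)^(-a) ≤ Real.exp (x^2/ρ) →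
      1/2 < E1mK a L x τ := by
  have hρ0 : 0 < ρ := by linarith
  have h2ρ : 2/ρ < 1 := by rwa [div_lt_one hρ0]
  have h2ρ' : 0 < 2/ρ := by positivity
  set ξ := (1 - 2/ρ)/4 with hξdef
  have hξ : 0 < ξ := by linarith
  have hξ4 : ξ < 1/4 := by linarith
  have hc0 := hL.2.2.2.1
  set J := ∫ t in Set.Ioi (0:ℝ), t ^ (-a-1) * L t with hJ
  have hJ0 : 0 ≤ J := setIntegral_nonneg measurableSet_Ioi fun t ht =>
    mul_nonneg (Real.rpow_nonneg (le_of_lt ht) _) (hL.2.1 t ht).le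
  obtain ⟨Y, hY⟩ := exists_exp_dominates (A := c0 * ξ^2 / 16) (B := ξ ^ (-a-1) * Mb) (D := J)
    (ρ := ρ) (by positivity) hξ4 (by linarith)
  refine ⟨Y, fun x τ hτ hτ0 hx hτρ => half_lt_E1mK hL.1 hL.2.1 hI hτ ?_⟩
  refine lt_of_lt_of_le ?_ (integral_centered_lower ha hL hI hτ hτ0 x hξ hξ4)
  have h1 := hY _ hx
  have h2 : Real.exp (ξ * x^2 / 2) * ((τ^2)^(-a) * J)
      ≤ Real.exp (ξ * x^2 / 2) * (Real.exp (x^2/ρ) * J) := by gcongr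
  linarith

lemma margIntegrand_le {a K l s x : ℝ} {L : ℝ → ℝ} (hl : 0 < l) (hLl : 0 < L l) (hK : 0 < K) :
    K * l ^ (-a-1) * L l *
      ((Real.sqrt (2 * Real.pi * (1 + l * s^2)))⁻¹ * Real.exp (-(x^2) / (2 * (1 + l * s^2))))
      ≤ K * (l ^ (-a-1) * L l) := by
  have h1 : 0 < 1 + l * s^2 := by positivity
  have hpi := Real.pi_gt_three
  have e1 : (Real.sqrt (2 * Real.pi * (1 + l * s^2)))⁻¹ ≤ 1 := by
    apply inv_le_one_of_one_le₀
    rw [Real.one_le_sqrt]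
    have : 0 ≤ l * s^2 := by positivity
    nlinarith
  have e2 : Real.exp (-(x^2) / (2 * (1 + l * s^2))) ≤ 1 := by
    rw [Real.exp_le_one_iff]
    exact div_nonpos_of_nonpos_of_nonneg (by nlinarith [sq_nonneg x]) (by positivity)
  have e3 : (Real.sqrt (2 * Real.pi * (1 + l * s^2)))⁻¹ *
      Real.exp (-(x^2) / (2 * (1 + l * s^2))) ≤ 1 :=
    mul_le_one₀ e1 (Real.exp_pos _).le e2
  have e4 : 0 ≤ K * (l ^ (-a-1) * L l) := by positivity
  calc _ = K * (l ^ (-a-1) * L l) * ((Real.sqrt (2 * Real.pi * (1 + l * s^2)))⁻¹ *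
      Real.exp (-(x^2) / (2 * (1 + l * s^2)))) := by ring
    _ ≤ K * (l ^ (-a-1) * L l) * 1 := by gcongr
    _ = _ := mul_one _

lemma margIntegrand_pos {a K l s x : ℝ} {L : ℝ → ℝ} (hl : 0 < l) (hLl : 0 < L l) (hK : 0 < K) :
    0 < K * l ^ (-a-1) * L l *
      ((Real.sqrt (2 * Real.pi * (1 + l * s^2)))⁻¹ *
        Real.exp (-(x^2) / (2 * (1 + l * s^2)))) := by
  have h1 : 0 < 1 + l * s^2 := by positivity
  have := Real.pi_pos
  positivity

lemma Kcond.pos {a K : ℝ} {L : ℝ → ℝ} (hK : Kcond a L K) : 0 < K := by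
  rw [hK.2.2]
  exact inv_pos.2 hK.2.1

lemma measurable_marg (a K : ℝ) {L : ℝ → ℝ} (hLm : Measurable L) (x : ℝ) :
    Measurable (fun s => marg a K L x s) := by
  unfold marg
  have h : Measurable (Function.uncurry fun s l : ℝ => K * l ^ (-a-1) * L l *
      ((Real.sqrt (2 * Real.pi * (1 + l * s^2)))⁻¹ *
        Real.exp (-(x^2) / (2 * (1 + l * s^2))))) := by
    unfold Function.uncurry
    fun_prop
  exact h.stronglyMeasurable.integral_prod_right.measurable

lemma integrableOn_margIntegrand {a K : ℝ} {L : ℝ → ℝ} (hLm : Measurable L)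
    (hL : ∀ t, 0 < t → 0 < L t) (hK : Kcond a L K) (x s : ℝ) :
    IntegrableOn (fun l => K * l ^ (-a-1) * L l *
      ((Real.sqrt (2 * Real.pi * (1 + l * s^2)))⁻¹ *
        Real.exp (-(x^2) / (2 * (1 + l * s^2))))) (Set.Ioi (0:ℝ)) := by
  refine Integrable.mono' (Integrable.const_mul hK.1 K) ?_ ?_
  · exact Measurable.aestronglyMeasurable (by fun_prop)
  · refine (ae_restrict_iff' measurableSet_Ioi).2 (.of_forall fun l hl => ?_)
    rw [Real.norm_of_nonneg (margIntegrand_pos hl (hL l hl) hK.pos).le]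
    exact margIntegrand_le hl (hL l hl) hK.pos

lemma marg_pos {a K : ℝ} {L : ℝ → ℝ} (hLm : Measurable L)
    (hL : ∀ t, 0 < t → 0 < L t) (hK : Kcond a L K) (x s : ℝ) : 0 < marg a K L x s := by
  unfold marg
  rw [setIntegral_pos_iff_support_of_nonneg_ae _ (integrableOn_margIntegrand hLm hL hK x s)]
  · refine lt_of_lt_of_le ?_ (measure_mono (Set.subset_inter
      (fun l (hl : l ∈ Set.Ioi (0:ℝ)) => (margIntegrand_pos hl (hL l hl) hK.pos).ne') subset_rfl))
    simp
  · exact (ae_restrict_iff' measurableSet_Ioi).2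
      (.of_forall fun l hl => (margIntegrand_pos hl (hL l hl) hK.pos).le)

lemma marg_le_one {a K : ℝ} {L : ℝ → ℝ} (hLm : Measurable L)
    (hL : ∀ t, 0 < t → 0 < L t) (hK : Kcond a L K) (x s : ℝ) : marg a K L x s ≤ 1 := by
  have h := setIntegral_mono_on (integrableOn_margIntegrand hLm hL hK x s)
    (Integrable.const_mul hK.1 K) measurableSet_Ioi
    (fun l hl => margIntegrand_le hl (hL l hl) hK.pos)
  rw [integral_const_mul, hK.2.2, inv_mul_cancel₀ hK.2.1.ne', ← hK.2.2] at h
  exact h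

lemma half_lt_fbShrink {a K : ℝ} {L : ℝ → ℝ} (hLm : Measurable L)
    (hL : ∀ t, 0 < t → 0 < L t) (hK : Kcond a L K) {π2 : ℝ → ℝ} {lo hi : ℝ} (hlo : 0 < lo)
    (hπ : ∀ τ, 0 ≤ π2 τ) (hπ1 : ∫ τ in Set.Icc lo hi, π2 τ = 1) {n : ℕ} (X : Fin n → ℝ) (i : Fin n)
    (h : ∀ τ ∈ Set.Icc lo hi, 1/2 < E1mK a L (X i) τ) :
    1/2 < fbShrink a K L π2 lo hi n X i := by
  have hπi : IntegrableOn π2 (Set.Icc lo hi) := by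
    by_contra hc
    rw [integral_undef hc] at hπ1
    exact zero_ne_one hπ1
  have hprod : ∀ s, 0 < ∏ j, marg a K L (X j) s :=
    fun s => Finset.prod_pos fun j _ => marg_pos hLm hL hK _ _
  have hprod1 : ∀ s, ∏ j, marg a K L (X j) s ≤ 1 := fun s =>
    Finset.prod_le_one (fun j _ => (marg_pos hLm hL hK _ _).le)
      fun j _ => marg_le_one hLm hL hK _ _
  have hprodm : Measurable fun s => ∏ j, marg a K L (X j) s :=
    Finset.measurable_fun_prod _ fun j _ => measurable_marg a K hLm _
  set w : ℝ → ℝ := fun s => π2 s * ∏ j, marg a K L (X j) s with hw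
  have hw0 : ∀ s, 0 ≤ w s := fun s => mul_nonneg (hπ s) (hprod s).le
  have hwi : IntegrableOn w (Set.Icc lo hi) :=
    Integrable.mul_bdd (c := 1) hπi hprodm.aestronglyMeasurable
      (.of_forall fun s => by rw [Real.norm_of_nonneg (hprod s).le]; exact hprod1 s)
  have hne : ∀ g : ℝ → ℝ, (∀ s ∈ Set.Icc lo hi, 0 < g s) →
      IntegrableOn (fun s => g s * π2 s) (Set.Icc lo hi) →
      0 < ∫ s in Set.Icc lo hi, g s * π2 s := by
    intro g hg hgi
    have hnn : 0 ≤ᵐ[volume.restrict (Set.Icc lo hi)] fun s => g s * π2 s :=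
      (ae_restrict_iff' measurableSet_Icc).2 (.of_forall fun s hs =>
        mul_nonneg (hg s hs).le (hπ s))
    refine lt_of_le_of_ne (integral_nonneg_of_ae hnn) fun h0 => ?_
    rw [eq_comm, integral_eq_zero_iff_of_nonneg_ae hnn hgi] at h0
    have hz : π2 =ᵐ[volume.restrict (Set.Icc lo hi)] 0 := by
      filter_upwards [h0, ae_restrict_mem measurableSet_Icc] with s hs hmem
      exact (mul_eq_zero.1 hs).resolve_left (hg s hmem).ne'
    rw [integral_congr_ae hz] at hπ1
    simp at hπ1
  have hD : 0 < ∫ s in Set.Icc lo hi, w s := by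
    have hwc : w = fun s => (∏ j, marg a K L (X j) s) * π2 s := by
      funext s; exact mul_comm _ _
    rw [hwc] at hwi ⊢
    exact hne _ (fun s _ => hprod s) hwi
  have hEi : IntegrableOn (fun τ => E1mK a L (X i) τ * w τ) (Set.Icc lo hi) := by
    refine Integrable.bdd_mul (c := 1) hwi (measurable_E1mK a hLm _).aestronglyMeasurable
      ((ae_restrict_iff' measurableSet_Icc).2 (.of_forall fun τ hτ => ?_))
    rw [Real.norm_of_nonneg (by linarith [h τ hτ])]
    exact E1mK_le_one hLm hL hK.1 (hlo.trans_le hτ.1) _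
  have hN : 0 < ∫ τ in Set.Icc lo hi, (E1mK a L (X i) τ * w τ - 1/2 * w τ) := by
    have hcongr : (fun τ => E1mK a L (X i) τ * w τ - 1/2 * w τ) = fun τ =>
        ((E1mK a L (X i) τ - 1/2) * ∏ j, marg a K L (X j) τ) * π2 τ := by
      funext τ; simp only [hw]; ring
    have hi' := hEi.sub (hwi.const_mul (1/2))
    simp only [hcongr]
    refine hne _ (fun s hs => mul_pos (by linarith [h s hs]) (hprod s)) ?_
    rw [← hcongr]
    exact hi'
  rw [integral_sub hEi (hwi.const_mul _), integral_const_mul] at hN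
  have hfb : fbShrink a K L π2 lo hi n X i
      = (∫ τ in Set.Icc lo hi, E1mK a L (X i) τ * w τ) / ∫ s in Set.Icc lo hi, w s := by
    unfold fbShrink tauWeight
    rw [← integral_div]
    refine integral_congr_ae (.of_forall fun τ => ?_)
    simp only [hw]
    ring
  rw [hfb, lt_div_iff₀ hD]
  linarith

lemma measureReal_Icc_neg_stdGaussian {z : ℝ} (hz : 0 ≤ z) :
    (gaussianReal 0 1).real (Set.Icc (-z) z) = 2 * Phi z - 1 := by
  have hneg : (gaussianReal 0 1).map (fun x => -x) = gaussianReal 0 1 := by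
    rw [gaussianReal_map_neg, neg_zero]
  have := nullSingletonClass_gaussianReal (μ := 0) (v := 1) one_ne_zero
  have h1 : (gaussianReal 0 1).real (Set.Iic (-z)) = 1 - Phi z := by
    have e1 : (gaussianReal 0 1).real (Set.Iic (-z)) = (gaussianReal 0 1).real (Set.Ici z) := by
      conv_lhs => rw [← hneg]
      rw [map_measureReal_apply measurable_neg measurableSet_Iic]
      congr 1
      ext x
      simp
    have e2 : (gaussianReal 0 1).real (Set.Ici z) = (gaussianReal 0 1).real (Set.Ioi z) :=
      measureReal_congr Ioi_ae_eq_Ici.symm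
    rw [e1, e2, ← Set.compl_Iic, probReal_compl_eq_one_sub measurableSet_Iic]
    rfl
  have h2 : (gaussianReal 0 1).real (Set.Icc (-z) z) = (gaussianReal 0 1).real (Set.Ioc (-z) z) :=
    measureReal_congr Ioc_ae_eq_Icc.symm
  rw [h2, ← Set.Iic_sdiff_Iic, measureReal_sdiff (Set.Iic_subset_Iic.2 (by linarith))
    measurableSet_Iic, h1]
  change Phi z - _ = _
  ring

lemma two_mul_Phi_sub_one_pos {z : ℝ} (hz : 0 < z) : 0 < 2 * Phi z - 1 := by
  rw [← measureReal_Icc_neg_stdGaussian hz.le, measureReal_def, ENNReal.toReal_pos_iff]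
  refine ⟨pos_iff_ne_zero.2 fun h0 => ?_, measure_lt_top _ _⟩
  have := gaussianReal_absolutelyContinuous' 0 one_ne_zero h0
  rw [Real.volume_Icc, ENNReal.ofReal_eq_zero] at this
  linarith

lemma continuous_Phi : Continuous Phi := by
  have hpdf := integrable_gaussianPDFReal 0 1
  have h : Phi = fun z => (∫ x in Set.Iic 0, gaussianPDFReal 0 1 x)
      + ∫ x in (0:ℝ)..z, gaussianPDFReal 0 1 x := by
    funext z
    rw [← intervalIntegral.integral_Iic_sub_Iic hpdf.integrableOn hpdf.integrableOn,
      add_sub_cancel, Phi, gaussianReal_apply_eq_integral 0 one_ne_zero,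
      ENNReal.toReal_ofReal (integral_nonneg fun x => gaussianPDFReal_nonneg 0 1 x)]
  rw [h]
  exact continuous_const.add
    (intervalIntegral.continuous_primitive (fun a b => hpdf.intervalIntegrable) 0)

lemma measureReal_Icc_neg_gaussian {v s : ℝ} (hv : 0 < v) (hs : 0 ≤ s) :
    (gaussianReal 0 (Real.toNNReal v)).real (Set.Icc (-s) s) = 2 * Phi (s / Real.sqrt v) - 1 := by
  have hsv : 0 < Real.sqrt v := Real.sqrt_pos.2 hv
  have hmap : (gaussianReal 0 1).map (fun x => Real.sqrt v * x)
      = gaussianReal 0 (Real.toNNReal v) := by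
    rw [gaussianReal_map_const_mul, mul_zero, mul_one]
    congr 1
    ext
    simp [Real.sq_sqrt hv.le, hv.le]
  rw [← hmap, map_measureReal_apply (by fun_prop) measurableSet_Icc,
    ← measureReal_Icc_neg_stdGaussian (by positivity)]
  congr 1
  ext x
  simp only [Set.mem_preimage, Set.mem_Icc]
  rw [← neg_div, div_le_iff₀ hsv, le_div_iff₀ hsv, mul_comm]

lemma isProbabilityMeasure_mixM {p : ℝ} (hp : 0 ≤ p ∧ p ≤ 1) (u : ℝ) :
    IsProbabilityMeasure (mixM p u) := by
  refine ⟨?_⟩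
  simp only [mixM, Measure.add_apply, Measure.smul_apply, measure_univ, smul_eq_mul, mul_one]
  rw [← ENNReal.ofReal_add (by linarith [hp.2]) hp.1]
  simp

lemma altMeas_eval_preimage {n : ℕ} (i : Fin n) {p : ℝ} (hp : 0 ≤ p ∧ p ≤ 1) (u : ℝ) {s : Set ℝ}
    (hs : MeasurableSet s) :
    altMeas n i p u (Function.eval i ⁻¹' s) = gaussianReal 0 (Real.toNNReal (1 + u)) s := by
  have := isProbabilityMeasure_mixM hp u
  have : ∀ j, IsProbabilityMeasure
      (if j = i then gaussianReal 0 (Real.toNNReal (1 + u)) else mixM p u) := by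
    intro j
    split_ifs <;> infer_instance
  have h := measurePreserving_eval
    (fun j => if j = i then gaussianReal 0 (Real.toNNReal (1 + u)) else mixM p u) i
  have h2 := h.measure_preimage hs.nullMeasurableSet
  simp only [if_true] at h2
  exact h2

/-- If the shrinkage weight exceeds `1/2` whenever `s < |X_i|`, the type II error is at most
`P(|N(0, 1+u)| ≤ s)`. -/
lemma t2FB_le {a K : ℝ} {L : ℝ → ℝ} {π2 : ℕ → ℝ → ℝ} {α p u : ℕ → ℝ} {n : ℕ}
    (hp : 0 ≤ p n ∧ p n ≤ 1) (hu : 0 < u n) (i : Fin n) {s : ℝ} (hs : 0 ≤ s)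
    (h : ∀ X : Fin n → ℝ, s < |X i| →
      1/2 < fbShrink a K L (π2 n) ((n:ℝ)⁻¹) (α n) n X i) :
    t2FB a K L π2 α p u n i ≤ 2 * Phi (s / Real.sqrt (1 + u n)) - 1 := by
  rw [← measureReal_Icc_neg_gaussian (by linarith) hs]
  unfold t2FB
  rw [measureReal_def, ← altMeas_eval_preimage i hp (u n) measurableSet_Icc]
  refine ENNReal.toReal_mono ?_ (measure_mono fun X hX => ?_)
  · rw [altMeas_eval_preimage i hp (u n) measurableSet_Icc]
    exact measure_ne_top _ _
  · by_contra hc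
    have : s < |X i| := by
      by_contra hle
      exact hc (abs_le.1 (not_lt.1 hle))
    exact absurd hX (not_le.2 (h X this))

lemma tendsto_log_div_variance {p u : ℕ → ℝ} {C e : ℝ} (hu : ∀ n, 0 < u n)
    (hA2 : Assump2 p u C) (he : 0 < e) (hpe : propToR p (-e)) :
    Tendsto (fun n : ℕ => Real.log n / (1 + u n)) atTop (nhds (C / (2 * e))) := by
  obtain ⟨hp0, hut, -, hlim⟩ := hA2
  obtain ⟨k1, k2, hk1, hk2, hk⟩ := hpe
  have hinv : Tendsto (fun n => (u n)⁻¹) atTop (nhds 0) := tendsto_inv_atTop_zero.comp hut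
  have hlogu : Tendsto (fun n => Real.log (u n) / u n) atTop (nhds 0) :=
    (Real.isLittleO_log_id_atTop.tendsto_div_nhds_zero).comp hut
  -- the remainder `log f_n - e log n` is bounded
  set r : ℕ → ℝ := fun n => Real.log ((1 - p n)/p n) - e * Real.log n with hr
  have hrb : ∀ᶠ n in atTop, |r n| ≤ |Real.log k1| + |Real.log k2| + Real.log 2 := by
    filter_upwards [hk, eventually_gt_atTop 0, hp0.eventually (gt_mem_nhds (show (0:ℝ) < 1/2 by
      norm_num))] with n hn hn0 hn2
    have hnp : (0:ℝ) < n := by exact_mod_cast hn0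
    have hne : 0 < (n:ℝ)^(-e) := Real.rpow_pos_of_pos hnp _
    have hpp : 0 < p n := lt_of_lt_of_le (by positivity) hn.1
    have l1 : Real.log k1 - e * Real.log n ≤ Real.log (p n) := by
      have := Real.log_le_log (by positivity) hn.1
      rw [Real.log_mul hk1.ne' hne.ne', Real.log_rpow hnp] at this
      linarith
    have l2 : Real.log (p n) ≤ Real.log k2 - e * Real.log n := by
      have := Real.log_le_log hpp hn.2
      rw [Real.log_mul hk2.ne' hne.ne', Real.log_rpow hnp] at this
      linarith
    have l3 : -Real.log 2 ≤ Real.log (1 - p n) := by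
      rw [← Real.log_inv]
      exact Real.log_le_log (by norm_num) (by linarith)
    have l4 : Real.log (1 - p n) ≤ 0 := Real.log_nonpos (by linarith) (by linarith)
    have hrn : r n = Real.log (1 - p n) - Real.log (p n) - e * Real.log n := by
      rw [hr]
      simp only
      rw [Real.log_div (by linarith) hpp.ne']
    have a1 := abs_le.1 (le_refl |Real.log k1|)
    have a2 := abs_le.1 (le_refl |Real.log k2|)
    have a3 : 0 < Real.log 2 := Real.log_pos (by norm_num)
    rw [hrn, abs_le]
    constructor <;> linarith [a1.1, a1.2, a2.1, a2.2]
  have hrt : Tendsto (fun n => r n * (u n)⁻¹) atTop (nhds 0) :=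
    bdd_le_mul_tendsto_zero' _ hrb hinv
  have h1u : Tendsto (fun n => (1 + (u n)⁻¹)⁻¹) atTop (nhds 1) := by
    have := (hinv.const_add 1).inv₀ (by norm_num)
    simpa using this
  have hcomb := (((hlim.sub hlogu).sub (hrt.const_mul 2)).mul_const ((2 * e)⁻¹)).mul h1u
  have hval : (C - 0 - 2 * 0) * (2 * e)⁻¹ * 1 = C / (2 * e) := by
    rw [div_eq_mul_inv]; ring
  rw [hval] at hcomb
  refine hcomb.congr' ?_
  filter_upwards [hk, eventually_gt_atTop 0, hp0.eventually (gt_mem_nhds (show (0:ℝ) < 1/2 by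
      norm_num))] with n hn hn0 hn2
  have hnp : (0:ℝ) < n := by exact_mod_cast hn0
  have hne : 0 < (n:ℝ)^(-e) := Real.rpow_pos_of_pos hnp _
  have hpp : 0 < p n := lt_of_lt_of_le (by positivity) hn.1
  have hf : 0 < (1 - p n)/p n := div_pos (by linarith) hpp
  have hun := hu n
  rw [Real.log_mul hun.ne' (by positivity), Real.log_pow]
  simp only [hr]
  field_simp
  push_cast
  ring

end PaperGL

open PaperGL MeasureTheory ProbabilityTheory Real Filter Set in
/-- Theorem 7: bound on the type II error probability of the full Bayes rule. -/
theorem stmt11 (a : ℝ) (ha : 0 < a ∧ a < 1) (L : ℝ → ℝ) (Mb c0 t0 K : ℝ)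
    (hL : AssumpL L Mb c0 t0) (hK : Kcond a L K)
    (π2 : ℕ → ℝ → ℝ) (α : ℕ → ℝ) (hC3 : CondC3 π2 α)
    (p u : ℕ → ℝ) (hp : ∀ n, 0 ≤ p n ∧ p n ≤ 1) (hu : ∀ n, 0 < u n)
    (C e : ℝ) (hA2 : Assump2 p u C) (he : 0 < e ∧ e ≤ 1) (hpe : propToR p (-e))
    (η δ ρ : ℝ) (hη : η ∈ Set.Ioo (0:ℝ) 1) (hδ : δ ∈ Set.Ioo (0:ℝ) 1)
    (hρ : 2/(η*(1-δ)) < ρ) :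
    ∃ ε : ℕ → ℝ, Tendsto ε atTop (nhds 0) ∧
      ∀ᶠ n : ℕ in atTop, ∀ i : Fin n,
        t2FB a K L π2 α p u n i ≤
          (2 * Phi (Real.sqrt (a*ρ*C/e)) - 1) * (1 + ε n) := by
  have hρ2 : 2 < ρ := by
    have h1 : 0 < 1 - δ := by linarith [hδ.2]
    have h2 : η * (1 - δ) < 1 := by nlinarith [hη.1, hη.2, hδ.1]
    have h3 : 0 < η * (1 - δ) := mul_pos hη.1 h1
    have h4 : 2 ≤ 2/(η*(1-δ)) := by rw [le_div_iff₀ h3]; linarith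
    linarith
  have hρ0 : 0 < ρ := by linarith
  have hC := hA2.2.2.1
  obtain ⟨ha0, ha1⟩ := ha
  obtain ⟨Y, hY⟩ := exists_half_lt_E1mK ⟨ha0, ha1⟩ hL hK.1 hρ2
  obtain ⟨hπ0, -, hπ1, hα, -⟩ := hC3
  set s : ℕ → ℝ := fun n => Real.sqrt (2 * a * ρ * Real.log n) with hs
  set z := Real.sqrt (a*ρ*C/e) with hz
  have hzpos : 0 < z := Real.sqrt_pos.2 (div_pos (by positivity) he.1)
  have hlim : Tendsto (fun n => 2 * Phi (s n / Real.sqrt (1 + u n)) - 1) atTop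
      (nhds (2 * Phi z - 1)) := by
    have h1 := (tendsto_log_div_variance hu hA2 he.1 hpe).const_mul (2 * a * ρ)
    have hval : 2 * a * ρ * (C / (2 * e)) = a*ρ*C/e := by
      have := he.1.ne'
      field_simp
    rw [hval] at h1
    have h2 := (Real.continuous_sqrt.tendsto _).comp h1
    have h3 := (((continuous_Phi.tendsto _).comp h2).const_mul 2).sub_const 1
    refine h3.congr fun n => ?_
    simp only [Function.comp_apply, hs]
    rw [← Real.sqrt_div' _ (by linarith [hu n]), mul_div_assoc]
  have hBpos := two_mul_Phi_sub_one_pos hzpos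
  refine ⟨fun n => (2 * Phi (s n / Real.sqrt (1 + u n)) - 1) / (2 * Phi z - 1) - 1, ?_, ?_⟩
  · have := (hlim.div_const (2 * Phi z - 1)).sub_const 1
    rwa [div_self hBpos.ne', sub_self] at this
  have hαt : ∀ᶠ n in atTop, t0 * (α n)^2 < 1 := by
    have := (hα.pow 2).const_mul t0
    rw [zero_pow two_ne_zero, mul_zero] at this
    exact this.eventually (gt_mem_nhds one_pos)
  have hlogt : Tendsto (fun n : ℕ => 2 * a * ρ * Real.log n) atTop atTop :=
    (Real.tendsto_log_atTop.comp tendsto_natCast_atTop_atTop).const_mul_atTop (by positivity)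
  filter_upwards [hαt, hlogt.eventually_ge_atTop Y, eventually_ge_atTop 1] with n hn1 hnY hn i
  have hmul : (2 * Phi z - 1) *
      (1 + ((2 * Phi (s n / Real.sqrt (1 + u n)) - 1) / (2 * Phi z - 1) - 1))
      = 2 * Phi (s n / Real.sqrt (1 + u n)) - 1 := by
    rw [add_sub_cancel, mul_div_cancel₀ _ hBpos.ne']
  rw [hmul]
  have hnpos : (0:ℝ) < n := by exact_mod_cast hn
  refine t2FB_le (hp n) (hu n) i (Real.sqrt_nonneg _) fun X hX => ?_
  have hlog0 : 0 ≤ Real.log n := Real.log_nonneg (by exact_mod_cast hn)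
  have hX2 : 2 * a * ρ * Real.log n ≤ (X i)^2 := by
    have h1 := (Real.sqrt_le_left (abs_nonneg (X i))).1 hX.le
    rwa [sq_abs] at h1
  have hlo : 0 < (n:ℝ)⁻¹ := inv_pos.2 hnpos
  refine half_lt_fbShrink hL.1 hL.2.1 hK hlo (hπ0 n) (hπ1 n hn) X i fun τ hτ => ?_
  have hτ0 : 0 < τ := hlo.trans_le hτ.1
  refine hY (X i) τ hτ0 ?_ (hnY.trans hX2) ?_
  · have ht0 := hL.2.2.2.2.1
    have : t0 * τ^2 ≤ t0 * (α n)^2 := by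
      have := hτ.2
      gcongr
    linarith
  · rw [Real.rpow_def_of_pos (by positivity)]
    apply Real.exp_le_exp.2
    rw [le_div_iff₀ hρ0, Real.log_pow]
    have h1 := Real.log_le_log hlo hτ.1
    rw [Real.log_inv] at h1
    push_cast
    have h2 : 0 ≤ (a * ρ) * (Real.log τ + Real.log n) := mul_nonneg (by positivity) (by linarith)
    linarith
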